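/- (Lemma 1) For every complex s with Re(s) > 1, one has (s(s+1)/(32 π² √2)) (2^{s/2} − 2^{−s/2}) (2^{(s−1)/2} − 2^{−(s−1)/2}) ζ*(s) ζ*(s+1) = Σ_{j=1}^∞ Σ_{d∣j} a(d) b(j/d) (j/d²)^{s/2} K(s, 2π√j), where ζ*(s) = π^{−s/2} Γ(s/2) ζ(s) is the completed Riemann zeta function, and the double series on the right converges absolutely. -/

import Mathlib

open scoped Real
open Real Complex MeasureTheory

noncomputable section

/-- `a(2^l * m) = 2^l * σ₁(m)` for `m` odd; in particular `a(n) = σ₁(n)` for odd `n`. -/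
def paperA (n : ℕ) : ℤ :=
  2 ^ (n.factorization 2) * (ArithmeticFunction.sigma 1 (ordCompl[2] n) : ℤ)

/-- `b(n) = σ₁(n)` for odd `n`, `b(n) = 0` for even `n`. -/
def paperB (n : ℕ) : ℤ :=
  if Odd n then (ArithmeticFunction.sigma 1 n : ℤ) else 0

/-- The modified Bessel function of the second kind,
`K(s, x) = (1/2) ∫_0^∞ u^{s−1} exp(−(x/2)(u + 1/u)) du`. -/
def besselK (s : ℂ) (x : ℝ) : ℂ :=
  (1 / 2) * ∫ u in Set.Ioi (0 : ℝ),
    (u : ℂ) ^ (s - 1) * Complex.exp (-((x : ℂ) / 2) * (u + 1 / u))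

/-- The completed Riemann zeta function `ζ*(s) = π^{−s/2} Γ(s/2) ζ(s)`. -/
def zetaStar (s : ℂ) : ℂ := (π : ℂ) ^ (-s / 2) * Complex.Gamma (s / 2) * riemannZeta s

/-- The general term of the double series of Lemma 1. -/
def lemma1Term (s : ℂ) (j d : ℕ) : ℂ :=
  (paperA d : ℂ) * (paperB (j / d) : ℂ) * ((j : ℂ) / (d : ℂ) ^ 2) ^ (s / 2) *
    besselK s (2 * π * Real.sqrt j)

/-- Positive quadruples `(a, b, x, y)` with `a * x + b * y = n`. -/
def quadruples (n : ℕ) : Finset (ℕ × ℕ × ℕ × ℕ) :=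
  (Finset.Icc 1 n ×ˢ Finset.Icc 1 n ×ˢ Finset.Icc 1 n ×ˢ Finset.Icc 1 n).filter
    fun p => p.1 * p.2.2.1 + p.2.1 * p.2.2.2 = n

lemma mem_quadruples {n a b x y : ℕ} :
    (a, b, x, y) ∈ quadruples n ↔ 0 < a ∧ 0 < b ∧ 0 < x ∧ 0 < y ∧ a * x + b * y = n := by
  simp only [quadruples, Finset.mem_filter, Finset.mem_product, Finset.mem_Icc]
  constructor
  · rintro ⟨⟨⟨h1, -⟩, ⟨h2, -⟩, ⟨h3, -⟩, ⟨h4, -⟩⟩, h⟩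
    exact ⟨h1, h2, h3, h4, h⟩
  · rintro ⟨h1, h2, h3, h4, h⟩
    refine ⟨⟨⟨h1, ?_⟩, ⟨h2, ?_⟩, ⟨h3, ?_⟩, ⟨h4, ?_⟩⟩, h⟩ <;> nlinarith

open Classical in
/-- The sum of `F` over the positive solutions of `a * x + b * y = n` satisfying `P`. -/
noncomputable def quadSum (n : ℕ) (P : ℕ → ℕ → ℕ → ℕ → Prop) (F : ℕ → ℕ → ℕ → ℕ → ℤ) : ℤ :=
  ∑ p ∈ (quadruples n).filter fun p => P p.1 p.2.1 p.2.2.1 p.2.2.2,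
    F p.1 p.2.1 p.2.2.1 p.2.2.2

lemma quadSum_shift (n : ℕ) {F H : ℕ → ℕ → ℕ → ℕ → ℤ}
    (h : ∀ a b x y, H a b (x + y) y = F a (a + b) x y) :
    quadSum n (fun _ _ x y => y < x) H = quadSum n (fun a b _ _ => a < b) F := by
  classical
  refine Finset.sum_nbij' (fun p => (p.1, p.1 + p.2.1, p.2.2.1 - p.2.2.2, p.2.2.2))
    (fun p => (p.1, p.2.1 - p.1, p.2.2.1 + p.2.2.2, p.2.2.2)) ?_ ?_ ?_ ?_ ?_
  · rintro ⟨a, b, x, y⟩ hp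
    simp only [Finset.mem_filter, mem_quadruples] at hp ⊢
    obtain ⟨⟨ha, hb, hx, hy, he⟩, hlt⟩ := hp
    obtain ⟨k, rfl⟩ := Nat.exists_eq_add_of_lt hlt
    have : y + k + 1 - y = k + 1 := by omega
    rw [this]
    refine ⟨⟨ha, by omega, by omega, hy, ?_⟩, by omega⟩
    rw [← he]; ring
  · rintro ⟨a, b, x, y⟩ hp
    simp only [Finset.mem_filter, mem_quadruples] at hp ⊢
    obtain ⟨⟨ha, hb, hx, hy, he⟩, hlt⟩ := hp
    obtain ⟨k, rfl⟩ := Nat.exists_eq_add_of_lt hlt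
    have : a + k + 1 - a = k + 1 := by omega
    rw [this]
    refine ⟨⟨ha, by omega, by omega, hy, ?_⟩, by omega⟩
    rw [← he]; ring
  · rintro ⟨a, b, x, y⟩ hp
    simp only [Finset.mem_filter] at hp
    simp [Nat.sub_add_cancel hp.2.le]
  · rintro ⟨a, b, x, y⟩ hp
    simp only [Finset.mem_filter] at hp
    simp [Nat.add_sub_cancel' hp.2.le]
  · rintro ⟨a, b, x, y⟩ hp
    simp only [Finset.mem_filter] at hp ⊢
    rw [← h, Nat.sub_add_cancel hp.2.le]

lemma quadSum_swap (n : ℕ) (P : ℕ → ℕ → ℕ → ℕ → Prop) (F : ℕ → ℕ → ℕ → ℕ → ℤ) :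
    quadSum n P F = quadSum n (fun a b x y => P b a y x) (fun a b x y => F b a y x) := by
  classical
  refine Finset.sum_nbij' (fun p => (p.2.1, p.1, p.2.2.2, p.2.2.1))
    (fun p => (p.2.1, p.1, p.2.2.2, p.2.2.1)) ?_ ?_ ?_ ?_ ?_
  · rintro ⟨a, b, x, y⟩ hp
    simp only [Finset.mem_filter, mem_quadruples] at hp ⊢
    exact ⟨⟨hp.1.2.1, hp.1.1, hp.1.2.2.2.1, hp.1.2.2.1, by linarith [hp.1.2.2.2.2]⟩, hp.2⟩
  · rintro ⟨a, b, x, y⟩ hp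
    simp only [Finset.mem_filter, mem_quadruples] at hp ⊢
    exact ⟨⟨hp.1.2.1, hp.1.1, hp.1.2.2.2.1, hp.1.2.2.1, by linarith [hp.1.2.2.2.2]⟩, hp.2⟩
  all_goals simp

lemma quadSum_shift_swap (n : ℕ) {F H : ℕ → ℕ → ℕ → ℕ → ℤ}
    (h : ∀ a b x y, H a b x (x + y) = F (a + b) b x y) :
    quadSum n (fun _ _ x y => x < y) H = quadSum n (fun a b _ _ => b < a) F := by
  rw [quadSum_swap n _ H, quadSum_swap n _ F]
  refine quadSum_shift n fun a b x y => ?_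
  rw [add_comm x y, h, add_comm]

lemma quadSum_congr (n : ℕ) {P : ℕ → ℕ → ℕ → ℕ → Prop} {F H : ℕ → ℕ → ℕ → ℕ → ℤ}
    (h : ∀ a b x y, P a b x y → F a b x y = H a b x y) : quadSum n P F = quadSum n P H := by
  classical
  exact Finset.sum_congr rfl fun p hp => h _ _ _ _ (Finset.mem_filter.1 hp).2

lemma quadSum_trichotomy (n : ℕ) (u v : ℕ → ℕ → ℕ → ℕ → ℕ) (F : ℕ → ℕ → ℕ → ℕ → ℤ) :
    quadSum n (fun _ _ _ _ => True) F =
      quadSum n (fun a b x y => u a b x y < v a b x y) F +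
      quadSum n (fun a b x y => v a b x y < u a b x y) F +
      quadSum n (fun a b x y => u a b x y = v a b x y) F := by
  classical
  simp only [quadSum, Finset.sum_filter, ← Finset.sum_add_distrib]
  refine Finset.sum_congr rfl fun p _ => ?_
  rcases lt_trichotomy (u p.1 p.2.1 p.2.2.1 p.2.2.2) (v p.1 p.2.1 p.2.2.1 p.2.2.2) with h | h | h
  · simp [h, h.not_gt, h.ne]
  · simp [h]
  · simp [h, h.not_gt, h.ne']

lemma quadSum_add (n : ℕ) (P : ℕ → ℕ → ℕ → ℕ → Prop) (F H : ℕ → ℕ → ℕ → ℕ → ℤ) :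
    quadSum n P (fun a b x y => F a b x y + H a b x y) = quadSum n P F + quadSum n P H := by
  simp only [quadSum, Finset.sum_add_distrib]

lemma quadSum_sub (n : ℕ) (P : ℕ → ℕ → ℕ → ℕ → Prop) (F H : ℕ → ℕ → ℕ → ℕ → ℤ) :
    quadSum n P (fun a b x y => F a b x y - H a b x y) = quadSum n P F - quadSum n P H := by
  simp only [quadSum, Finset.sum_sub_distrib]

lemma quadSum_eq_xy (n : ℕ) (F : ℕ → ℕ → ℕ → ℕ → ℤ) :
    quadSum n (fun _ _ x y => x = y) F =
      ∑ p ∈ n.divisorsAntidiagonal, ∑ a ∈ Finset.Ico 1 p.1, F a (p.1 - a) p.2 p.2 := by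
  classical
  rw [Finset.sum_sigma']
  refine Finset.sum_nbij' (fun p => ⟨(p.1 + p.2.1, p.2.2.1), p.1⟩)
    (fun p => (p.2, p.1.1 - p.2, p.1.2, p.1.2)) ?_ ?_ ?_ ?_ ?_
  · rintro ⟨a, b, x, y⟩ hp
    simp only [Finset.mem_filter, mem_quadruples, Finset.mem_sigma, Finset.mem_Ico,
      Nat.mem_divisorsAntidiagonal] at hp ⊢
    obtain ⟨⟨ha, hb, hx, hy, he⟩, rfl⟩ := hp
    refine ⟨⟨by rw [← he]; ring, ?_⟩, ha, by omega⟩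
    have := Nat.mul_pos ha hx
    omega
  · rintro ⟨⟨d, e⟩, a⟩ hp
    simp only [Finset.mem_filter, mem_quadruples, Finset.mem_sigma, Finset.mem_Ico,
      Nat.mem_divisorsAntidiagonal] at hp ⊢
    obtain ⟨⟨he, hn⟩, ha, hd⟩ := hp
    have he0 : 0 < e := Nat.pos_of_ne_zero fun h => hn (by rw [← he, h, mul_zero])
    refine ⟨⟨ha, by omega, he0, he0, ?_⟩, trivial⟩
    rw [← add_mul, Nat.add_sub_cancel' hd.le, he]
  · rintro ⟨a, b, x, y⟩ hp
    simp only [Finset.mem_filter] at hp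
    simp [hp.2]
  · rintro ⟨⟨d, e⟩, a⟩ hp
    simp only [Finset.mem_sigma, Finset.mem_Ico] at hp
    simp [Nat.add_sub_cancel' hp.2.2.le]
  · rintro ⟨a, b, x, y⟩ hp
    simp only [Finset.mem_filter] at hp
    simp [hp.2]

lemma quadSum_eq_ab (n : ℕ) (F : ℕ → ℕ → ℕ → ℕ → ℤ) :
    quadSum n (fun a b _ _ => a = b) F =
      ∑ p ∈ n.divisorsAntidiagonal, ∑ x ∈ Finset.Ico 1 p.2, F p.1 p.1 x (p.2 - x) := by
  classical
  rw [Finset.sum_sigma']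
  refine Finset.sum_nbij' (fun p => ⟨(p.1, p.2.2.1 + p.2.2.2), p.2.2.1⟩)
    (fun p => (p.1.1, p.1.1, p.2, p.1.2 - p.2)) ?_ ?_ ?_ ?_ ?_
  · rintro ⟨a, b, x, y⟩ hp
    simp only [Finset.mem_filter, mem_quadruples, Finset.mem_sigma, Finset.mem_Ico,
      Nat.mem_divisorsAntidiagonal] at hp ⊢
    obtain ⟨⟨ha, hb, hx, hy, he⟩, rfl⟩ := hp
    refine ⟨⟨by rw [← he]; ring, ?_⟩, hx, by omega⟩
    have := Nat.mul_pos ha hx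
    omega
  · rintro ⟨⟨d, e⟩, x⟩ hp
    simp only [Finset.mem_filter, mem_quadruples, Finset.mem_sigma, Finset.mem_Ico,
      Nat.mem_divisorsAntidiagonal] at hp ⊢
    obtain ⟨⟨he, hn⟩, hx, hd⟩ := hp
    have hd0 : 0 < d := Nat.pos_of_ne_zero fun h => hn (by rw [← he, h, zero_mul])
    refine ⟨⟨hd0, hd0, hx, by omega, ?_⟩, trivial⟩
    rw [← mul_add, Nat.add_sub_cancel' hd.le, he]
  · rintro ⟨a, b, x, y⟩ hp
    simp only [Finset.mem_filter] at hp
    simp [hp.2]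
  · rintro ⟨⟨d, e⟩, a⟩ hp
    simp only [Finset.mem_sigma, Finset.mem_Ico] at hp
    simp [Nat.add_sub_cancel' hp.2.2.le]
  · rintro ⟨a, b, x, y⟩ hp
    simp only [Finset.mem_filter] at hp
    simp [hp.2]

lemma sum_antidiagonal_mul_eq_quadSum (n : ℕ) (f g : ℕ → ℕ → ℤ) :
    ∑ p ∈ Finset.HasAntidiagonal.antidiagonal n, (∑ u ∈ p.1.divisorsAntidiagonal, f u.1 u.2) *
        (∑ v ∈ p.2.divisorsAntidiagonal, g v.1 v.2) =
      quadSum n (fun _ _ _ _ => True) (fun a b x y => f a x * g b y) := by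
  classical
  simp only [Finset.sum_mul_sum, ← Finset.sum_product']
  rw [Finset.sum_sigma']
  refine Finset.sum_nbij' (fun p => (p.2.1.1, p.2.2.1, p.2.1.2, p.2.2.2))
    (fun p => ⟨(p.1 * p.2.2.1, p.2.1 * p.2.2.2), ((p.1, p.2.2.1), (p.2.1, p.2.2.2))⟩) ?_ ?_ ?_ ?_ ?_
  · rintro ⟨⟨j, k⟩, ⟨a, x⟩, ⟨b, y⟩⟩ hp
    simp only [Finset.mem_filter, mem_quadruples, Finset.mem_sigma, Finset.mem_product,
      Nat.mem_divisorsAntidiagonal, Finset.HasAntidiagonal.mem_antidiagonal] at hp ⊢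
    obtain ⟨h, ⟨rfl, h1⟩, rfl, h2⟩ := hp
    simp only [ne_eq, mul_eq_zero, not_or] at h1 h2
    exact ⟨⟨by omega, by omega, by omega, by omega, h⟩, trivial⟩
  · rintro ⟨a, b, x, y⟩ hp
    simp only [Finset.mem_filter, mem_quadruples, Finset.mem_sigma, Finset.mem_product,
      Nat.mem_divisorsAntidiagonal, Finset.HasAntidiagonal.mem_antidiagonal] at hp ⊢
    obtain ⟨⟨ha, hb, hx, hy, he⟩, -⟩ := hp
    exact ⟨he, ⟨trivial, by positivity⟩, trivial, by positivity⟩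
  · rintro ⟨⟨j, k⟩, ⟨a, x⟩, ⟨b, y⟩⟩ hp
    simp only [Finset.mem_sigma, Finset.mem_product, Nat.mem_divisorsAntidiagonal] at hp
    obtain ⟨h, ⟨rfl, h1⟩, rfl, h2⟩ := hp
    rfl
  · simp
  · simp

lemma two_mul_sum_neg_one_pow {e : ℕ} (he : 1 ≤ e) :
    2 * ∑ x ∈ Finset.Ico 1 e, (-1 : ℤ) ^ x = -(1 + (-1) ^ e) := by
  induction e, he using Nat.le_induction with
  | base => simp
  | succ k hk ih => rw [Finset.sum_Ico_succ_top hk, mul_add, ih]; ring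

lemma two_mul_sum_neg_one_pow_mul_sq {d : ℕ} (hd : 1 ≤ d) :
    2 * ∑ x ∈ Finset.Ico 1 d, (-1 : ℤ) ^ x * (x : ℤ) ^ 2 = -(-1) ^ d * (d * (d - 1)) := by
  induction d, hd using Nat.le_induction with
  | base => simp
  | succ k hk ih => rw [Finset.sum_Ico_succ_top hk, mul_add, ih]; push_cast; ring

/-- The convolution of `(1 - (-1) ^ x) * a` and `(-1) ^ (b + y) * b` in terms of divisor sums. -/
lemma quadSum_alternating (n : ℕ) :
    -4 * quadSum n (fun _ _ _ _ => True)
        (fun a b x y => (1 - (-1) ^ x) * a * ((-1) ^ (b + y) * b)) =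
      ∑ p ∈ n.divisorsAntidiagonal,
        (n * ((-1) ^ (p.1 + p.2) * p.1) - if Odd p.2 then (p.1 : ℤ) else 0) := by
  set h : ℕ → ℕ → ℕ → ℕ → ℤ := fun a b x y => (a : ℤ) ^ 2 *
    (((-1) ^ x - 1) * (-1) ^ b * (-1) ^ y + ((-1) ^ x - (-1) ^ y) * (-1) ^ a * (-1) ^ b) with hh
  set M : ℕ → ℕ → ℕ → ℕ → ℤ := fun a b x y =>
    (1 - (-1) ^ x) * (-1) ^ b * (-1) ^ y * ((a : ℤ) - b) ^ 2 with hM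
  set N : ℕ → ℕ → ℕ → ℕ → ℤ := fun a b x y =>
    (1 - (-1) ^ x) * (-1) ^ b * (-1) ^ y * ((a : ℤ) + b) ^ 2 with hN
  set H1 : ℕ → ℕ → ℕ → ℕ → ℤ := fun a b x y =>
    (a : ℤ) ^ 2 * (((-1) ^ x - 1) * (-1) ^ b * (-1) ^ y) with hH1
  set H2 : ℕ → ℕ → ℕ → ℕ → ℤ := fun a b x y =>
    (a : ℤ) ^ 2 * (((-1) ^ x - (-1) ^ y) * (-1) ^ a * (-1) ^ b) with hH2
  have sq : ∀ k : ℕ, ((-1 : ℤ) ^ k) * (-1) ^ k = 1 := fun k => by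
    rw [← mul_pow]; simp
  have e0 : -4 * quadSum n (fun _ _ _ _ => True)
        (fun a b x y => (1 - (-1) ^ x) * a * ((-1) ^ (b + y) * b)) =
      quadSum n (fun _ _ _ _ => True) M - quadSum n (fun _ _ _ _ => True) N := by
    rw [← quadSum_sub]
    classical
    simp only [quadSum, Finset.mul_sum]
    refine Finset.sum_congr rfl fun p _ => ?_
    simp only [hM, hN, pow_add]; ring
  have m1 : quadSum n (fun a b _ _ => b < a) M = quadSum n (fun _ _ x y => x < y) H1 := by
    symm
    refine quadSum_shift_swap n fun a b x y => ?_
    simp only [hM, hH1, pow_add]; push_cast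
    linear_combination (a:ℤ)^2 * (-1) ^ b * (-1) ^ y * sq x
  have m2 : quadSum n (fun a b _ _ => a < b) M = quadSum n (fun _ _ x y => x < y) H2 := by
    rw [quadSum_swap n (fun _ _ x y => x < y)]
    symm
    refine quadSum_shift n fun a b x y => ?_
    simp only [hM, hH2, pow_add]; push_cast
    ring
  have m3 : quadSum n (fun a b _ _ => a = b) M = 0 := by
    rw [quadSum_congr n (H := fun _ _ _ _ => 0)]
    · simp [quadSum]
    · rintro a b x y rfl
      simp [hM]
  have n1 : quadSum n (fun _ _ x y => x < y) N = quadSum n (fun a b _ _ => b < a) H1 := by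
    refine quadSum_shift_swap n fun a b x y => ?_
    simp only [hN, hH1, pow_add]; push_cast
    linear_combination -((a:ℤ)+b)^2 * (-1) ^ b * (-1) ^ y * sq x
  have n2 : quadSum n (fun _ _ x y => y < x) N = quadSum n (fun a b _ _ => b < a) H2 := by
    rw [quadSum_swap n (fun a b _ _ => b < a)]
    refine quadSum_shift n fun a b x y => ?_
    simp only [hN, hH2, pow_add]; push_cast
    linear_combination (-((a:ℤ)+b)^2 * (-1) ^ b * (-1) ^ x) * sq y -
       ((a:ℤ)+b)^2 * ((-1) ^ y - (-1) ^ x) * (-1) ^ b * sq a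
  have hsum : ∀ P, quadSum n P h = quadSum n P H1 + quadSum n P H2 := fun P => by
    rw [← quadSum_add]
    refine quadSum_congr n fun a b x y _ => ?_
    simp only [hh, hH1, hH2]; ring
  have hinv : quadSum n (fun _ _ x y => y < x) h = quadSum n (fun a b _ _ => a < b) h := by
    refine quadSum_shift n fun a b x y => ?_
    simp only [hh, pow_add]
    linear_combination ((a:ℤ)^2 * (-1) ^ x * (-1) ^ b) * sq y -
       (a:ℤ)^2 * ((-1) ^ x - (-1) ^ y) * (-1) ^ b * sq a
  have t1 := quadSum_trichotomy n (fun a _ _ _ => a) (fun _ b _ _ => b) M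
  have t2 := quadSum_trichotomy n (fun _ _ x _ => x) (fun _ _ _ y => y) N
  have t3 := quadSum_trichotomy n (fun a _ _ _ => a) (fun _ b _ _ => b) h
  have t4 := quadSum_trichotomy n (fun _ _ x _ => x) (fun _ _ _ y => y) h
  have s1 := hsum (fun _ _ x y => x < y)
  have s2 := hsum (fun a b _ _ => b < a)
  have key : quadSum n (fun _ _ _ _ => True) M - quadSum n (fun _ _ _ _ => True) N =
      quadSum n (fun a b _ _ => a = b) h - (quadSum n (fun _ _ x y => x = y) h +
        quadSum n (fun _ _ x y => x = y) N) := by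
    linarith
  rw [e0, key, ← quadSum_add, quadSum_eq_ab, quadSum_eq_xy, ← Finset.sum_sub_distrib]
  refine Finset.sum_congr rfl fun p hp => ?_
  obtain ⟨d, e⟩ := p
  obtain ⟨hde, hn⟩ := Nat.mem_divisorsAntidiagonal.1 hp
  simp only at hde ⊢
  have hd1 : 1 ≤ d := Nat.pos_of_ne_zero fun h => hn (by rw [← hde, h, zero_mul])
  have he1 : 1 ≤ e := Nat.pos_of_ne_zero fun h => hn (by rw [← hde, h, mul_zero])
  have q1 : ∑ x ∈ Finset.Ico 1 e, h d d x (e - x) =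
      d ^ 2 * ((-1) ^ d * (-1) ^ e * (e - 1) +
        (1 - (-1) ^ e - (-1) ^ d * (-1) ^ e) * ∑ x ∈ Finset.Ico 1 e, (-1) ^ x) := by
    have : ∀ x ∈ Finset.Ico 1 e, h d d x (e - x) = (d : ℤ) ^ 2 * ((-1) ^ d * (-1) ^ e) +
        d ^ 2 * (1 - (-1) ^ e - (-1) ^ d * (-1) ^ e) * (-1) ^ x := by
      intro x hx
      have hx := Finset.mem_Ico.1 hx
      obtain ⟨k, rfl⟩ := Nat.exists_eq_add_of_le hx.2.le
      simp only [hh, Nat.add_sub_cancel_left, pow_add]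
      linear_combination ((d:ℤ)^2 * ((-1) ^ x - (-1) ^ k)) * sq d +
        ((d:ℤ)^2 * (-1) ^ k * (1 + (-1) ^ d)) * sq x
    rw [Finset.sum_congr rfl this, Finset.sum_add_distrib, Finset.sum_const, ← Finset.mul_sum,
      Nat.card_Ico, nsmul_eq_mul]
    push_cast [Nat.cast_sub he1]
    ring
  have q2 : ∑ a ∈ Finset.Ico 1 d, (h a (d - a) e e + N a (d - a) e e) =
      (1 - (-1) ^ e) * (-1) ^ d * (∑ a ∈ Finset.Ico 1 d, (-1) ^ a * (a : ℤ) ^ 2 -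
        d ^ 2 * ∑ a ∈ Finset.Ico 1 d, (-1) ^ a) := by
    rw [Finset.mul_sum, ← Finset.sum_sub_distrib, Finset.mul_sum]
    refine Finset.sum_congr rfl fun a ha => ?_
    have ha := Finset.mem_Ico.1 ha
    obtain ⟨k, rfl⟩ := Nat.exists_eq_add_of_le ha.2.le
    simp only [hh, hN, Nat.add_sub_cancel_left, pow_add]
    push_cast
    linear_combination ((a:ℤ)^2 - ((a:ℤ) + k)^2) * (-1) ^ k * sq e  -
      (1 - (-1) ^ e) * (-1) ^ k * ((a : ℤ) ^ 2 - (a + k) ^ 2) * sq a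
  rw [q1, q2]
  have r1 := two_mul_sum_neg_one_pow he1
  have r2 := two_mul_sum_neg_one_pow hd1
  have r3 := two_mul_sum_neg_one_pow_mul_sq hd1
  have r4 : 2 * (if Odd e then (d : ℤ) else 0) = (1 - (-1) ^ e) * d := by
    split_ifs with ho
    · rw [ho.neg_one_pow]; ring
    · rw [(Nat.not_odd_iff_even.1 ho).neg_one_pow]; ring
  have r5 : (n : ℤ) = d * e := by exact_mod_cast hde.symm
  rw [r5, pow_add]
  apply mul_left_cancel₀ (two_ne_zero : (2 : ℤ) ≠ 0)
  have se := sq e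
  have sd := sq d
  have r4' : 2 * ((d * e : ℤ) * ((-1) ^ d * (-1) ^ e * d) - (if Odd e then (d : ℤ) else 0)) =
    2 * (d * e : ℤ) * ((-1) ^ d * (-1) ^ e * d) - (1 - (-1) ^ e) * d := by linarith
  rw [r4']
  generalize (∑ x ∈ Finset.Ico 1 e, (-1 : ℤ) ^ x) = A at *
  generalize (∑ x ∈ Finset.Ico 1 d, (-1 : ℤ) ^ x) = B at *
  generalize (∑ a ∈ Finset.Ico 1 d, (-1 : ℤ) ^ a * (a : ℤ) ^ 2) = C at *
  generalize (-1 : ℤ) ^ e = u at *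
  generalize (-1 : ℤ) ^ d = v at *
  have hA : 2 * (d ^ 2 * (v * u * (e - 1) + (1 - u - v * u) * A) - (1 - u) * v * (C - d ^ 2 * B))
     = (d:ℤ) ^ 2 * (2 * (v * u * (e - 1)) + (1 - u - v * u) * (-(1 + u))) -
       (1 - u) * v * (-v * (d * (d - 1)) - d ^ 2 * (-(1 + v))) := by
    rw [← r1, ← r2, ← r3]; ring
  rw [hA]
  linear_combination ((d:ℤ)^2 * (1 + v)) * se + ((1-u) * (d * (d - 1) - (d:ℤ)^2)) * sd

/-- The sum of the divisors of `n` with odd cofactor. -/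
def oddCofactorSum (n : ℕ) : ℤ :=
  ∑ p ∈ n.divisorsAntidiagonal, if Odd p.2 then (p.1 : ℤ) else 0

/-- The alternating divisor sum `∑ (-1) ^ (d + e) * d` over `d * e = n`. -/
def altSigma (n : ℕ) : ℤ :=
  ∑ p ∈ n.divisorsAntidiagonal, (-1) ^ (p.1 + p.2) * (p.1 : ℤ)

lemma eight_mul_sum_antidiagonal (n : ℕ) :
    8 * ∑ p ∈ Finset.HasAntidiagonal.antidiagonal n, oddCofactorSum p.1 * altSigma p.2 =
      oddCofactorSum n - n * altSigma n := by
  have h1 := quadSum_alternating n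
  rw [← sum_antidiagonal_mul_eq_quadSum n (fun a x => (1 - (-1) ^ x) * (a : ℤ))
    (fun b y => (-1) ^ (b + y) * (b : ℤ))] at h1
  have h2 : ∀ k : ℕ, ∑ u ∈ k.divisorsAntidiagonal, (1 - (-1) ^ u.2) * (u.1 : ℤ) =
      2 * oddCofactorSum k := fun k => by
    rw [oddCofactorSum, Finset.mul_sum]
    refine Finset.sum_congr rfl fun u _ => ?_
    split_ifs with ho
    · rw [ho.neg_one_pow]; ring
    · rw [(Nat.not_odd_iff_even.1 ho).neg_one_pow]; ring
  have h3 : ∀ k : ℕ, ∑ u ∈ k.divisorsAntidiagonal, (-1) ^ (u.1 + u.2) * (u.1 : ℤ) = altSigma k :=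
    fun _ => rfl
  have h4 : ∑ u ∈ n.divisorsAntidiagonal, (if Odd u.2 then (u.1 : ℤ) else 0) = oddCofactorSum n :=
    rfl
  simp only [h2, h3, h4, mul_assoc, ← Finset.mul_sum, Finset.sum_sub_distrib] at h1
  linarith

lemma paperA_eq_oddCofactorSum (n : ℕ) : paperA n = oddCofactorSum n := by
  rcases Nat.eq_zero_or_pos n with rfl | hn
  · simp [paperA, oddCofactorSum]
  have hm : ordProj[2] n * ordCompl[2] n = n := Nat.ordProj_mul_ordCompl_eq_self n 2
  have hodd : Odd (ordCompl[2] n) := by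
    rw [← Nat.not_even_iff_odd, even_iff_two_dvd]
    exact Nat.not_dvd_ordCompl Nat.prime_two hn.ne'
  rw [paperA, oddCofactorSum, ← Finset.sum_filter, ArithmeticFunction.sigma_one_apply]
  generalize ordCompl[2] n = m at *
  generalize n.factorization 2 = l at *
  have hm0 : 0 < m := hodd.pos
  have hl : 0 < 2 ^ l := by positivity
  push_cast
  rw [Finset.mul_sum]
  refine Finset.sum_nbij' (fun d => (2 ^ l * d, m / d)) (fun p => p.1 / 2 ^ l) ?_ ?_ ?_ ?_ ?_
  · intro d hd
    obtain ⟨e, rfl⟩ := Nat.dvd_of_mem_divisors hd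
    have hd0 : 0 < d := Nat.pos_of_mul_pos_right hm0
    rw [Nat.mul_div_cancel_left e hd0]
    simp only [Finset.mem_filter, Nat.mem_divisorsAntidiagonal]
    exact ⟨⟨by rw [← hm]; ring, hn.ne'⟩, (Nat.odd_mul.1 hodd).2⟩
  · rintro ⟨d, e⟩ hp
    simp only [Finset.mem_filter, Nat.mem_divisorsAntidiagonal] at hp
    obtain ⟨⟨h, -⟩, ho⟩ := hp
    have hdvd : 2 ^ l ∣ d := by
      refine (Nat.Coprime.pow_left l (Nat.coprime_two_left.2 ho)).dvd_of_dvd_mul_right ?_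
      rw [h, ← hm]; exact dvd_mul_right _ _
    obtain ⟨k, rfl⟩ := hdvd
    rw [Nat.mul_div_cancel_left k hl, Nat.mem_divisors]
    refine ⟨⟨e, Nat.eq_of_mul_eq_mul_left hl ?_⟩, hm0.ne'⟩
    rw [hm, ← h]; ring
  · intro d _
    exact Nat.mul_div_cancel_left d hl
  · rintro ⟨d, e⟩ hp
    simp only [Finset.mem_filter, Nat.mem_divisorsAntidiagonal] at hp
    obtain ⟨⟨h, -⟩, ho⟩ := hp
    have hdvd : 2 ^ l ∣ d := by
      refine (Nat.Coprime.pow_left l (Nat.coprime_two_left.2 ho)).dvd_of_dvd_mul_right ?_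
      rw [h, ← hm]; exact dvd_mul_right _ _
    obtain ⟨k, rfl⟩ := hdvd
    rw [Nat.mul_div_cancel_left k hl]
    have hk : m = k * e := Nat.eq_of_mul_eq_mul_left hl (by rw [hm, ← h]; ring)
    rw [hk, Nat.mul_div_cancel_left e (Nat.pos_of_mul_pos_right (hk ▸ hm0))]
  · intro d _
    push_cast; rfl

/-- The function `n ↦ g (n / 2)` on even `n`, extended by zero. -/
def dilate (g : ℕ → ℤ) (n : ℕ) : ℤ := if Even n then g (n / 2) else 0

lemma sum_even_snd (n : ℕ) (f : ℕ → ℕ → ℤ) :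
    ∑ p ∈ n.divisorsAntidiagonal, (if Even p.2 then f p.1 p.2 else 0) =
      dilate (fun k => ∑ p ∈ k.divisorsAntidiagonal, f p.1 (2 * p.2)) n := by
  rw [dilate]
  split_ifs with hn
  · obtain ⟨k, rfl⟩ := hn
    rw [← two_mul, Nat.mul_div_cancel_left k two_pos, ← Finset.sum_filter]
    refine Finset.sum_nbij' (fun p => (p.1, p.2 / 2)) (fun p => (p.1, 2 * p.2)) ?_ ?_ ?_ ?_ ?_
    · rintro ⟨d, e⟩ hp
      simp only [Finset.mem_filter, Nat.mem_divisorsAntidiagonal] at hp ⊢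
      obtain ⟨⟨h, h0⟩, r, rfl⟩ := hp
      rw [← two_mul, Nat.mul_div_cancel_left r two_pos]
      refine ⟨?_, by omega⟩
      linarith
    · rintro ⟨d, e⟩ hp
      simp only [Finset.mem_filter, Nat.mem_divisorsAntidiagonal] at hp ⊢
      obtain ⟨h, h0⟩ := hp
      refine ⟨⟨by rw [← h]; ring, by omega⟩, even_two_mul e⟩
    · rintro ⟨d, e⟩ hp
      simp only [Finset.mem_filter] at hp
      simp [Nat.two_mul_div_two_of_even hp.2]
    · simp
    · rintro ⟨d, e⟩ hp
      simp only [Finset.mem_filter] at hp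
      simp [Nat.two_mul_div_two_of_even hp.2]
  · refine Finset.sum_eq_zero fun p hp => if_neg fun he => hn ?_
    rw [← (Nat.mem_divisorsAntidiagonal.1 hp).1]
    exact he.mul_left _

/-- The sum of the divisors of `n`, as an integer. -/
def sigmaInt (n : ℕ) : ℤ := (ArithmeticFunction.sigma 1 n : ℤ)

lemma sigmaInt_eq (n : ℕ) : sigmaInt n = ∑ p ∈ n.divisorsAntidiagonal, (p.1 : ℤ) := by
  rw [sigmaInt, ArithmeticFunction.sigma_one_apply,
    Nat.sum_divisorsAntidiagonal (fun i _ => (i : ℤ))]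
  push_cast; rfl

lemma sum_divisorsAntidiagonal_swap (n : ℕ) (f : ℕ → ℕ → ℤ) :
    ∑ p ∈ n.divisorsAntidiagonal, f p.2 p.1 = ∑ p ∈ n.divisorsAntidiagonal, f p.1 p.2 := by
  rw [Nat.sum_divisorsAntidiagonal f, Nat.sum_divisorsAntidiagonal' fun i j => f j i]

lemma sum_even_snd_fst (n : ℕ) :
    ∑ p ∈ n.divisorsAntidiagonal, (if Even p.2 then (p.1 : ℤ) else 0) = dilate sigmaInt n := by
  rw [sum_even_snd n (fun a _ => (a : ℤ))]
  simp only [dilate, sigmaInt_eq]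

lemma sum_even_fst_fst (n : ℕ) :
    ∑ p ∈ n.divisorsAntidiagonal, (if Even p.1 then (p.1 : ℤ) else 0) =
      2 * dilate sigmaInt n := by
  rw [← sum_divisorsAntidiagonal_swap n fun a _ => if Even a then (a : ℤ) else 0,
    sum_even_snd n (fun _ a => (a : ℤ))]
  simp only [dilate, sigmaInt_eq, Nat.cast_mul, Nat.cast_ofNat, ← Finset.mul_sum, mul_ite, mul_zero,
    sum_divisorsAntidiagonal_swap _ fun a _ => (a : ℤ)]

lemma sum_even_even_fst (n : ℕ) :
    ∑ p ∈ n.divisorsAntidiagonal, (if Even p.2 then if Even p.1 then (p.1 : ℤ) else 0 else 0) =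
      2 * dilate (dilate sigmaInt) n := by
  rw [sum_even_snd n (fun a _ => if Even a then (a : ℤ) else 0)]
  simp only [sum_even_fst_fst]
  simp only [dilate]
  split_ifs <;> simp

lemma altSigma_eq (n : ℕ) :
    altSigma n = sigmaInt n - 6 * dilate sigmaInt n + 8 * dilate (dilate sigmaInt) n := by
  have : altSigma n = sigmaInt n - 2 * ∑ p ∈ n.divisorsAntidiagonal,
      (if Even p.2 then (p.1 : ℤ) else 0) - 2 * ∑ p ∈ n.divisorsAntidiagonal,
      (if Even p.1 then (p.1 : ℤ) else 0) + 4 * ∑ p ∈ n.divisorsAntidiagonal,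
      (if Even p.2 then if Even p.1 then (p.1 : ℤ) else 0 else 0) := by
    rw [altSigma, sigmaInt_eq]
    simp only [Finset.mul_sum, ← Finset.sum_sub_distrib, ← Finset.sum_add_distrib]
    refine Finset.sum_congr rfl fun p _ => ?_
    rw [pow_add]
    rcases Nat.even_or_odd p.1 with h1 | h1 <;> rcases Nat.even_or_odd p.2 with h2 | h2 <;>
    simp [h1, h2, h1.neg_one_pow, h2.neg_one_pow, Nat.not_even_iff_odd.2] <;> ring
  rw [this, sum_even_snd_fst, sum_even_fst_fst, sum_even_even_fst]; ring

lemma paperB_eq (n : ℕ) :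
    paperB n = sigmaInt n - 3 * dilate sigmaInt n + 2 * dilate (dilate sigmaInt) n := by
  have : paperB n = sigmaInt n - ∑ p ∈ n.divisorsAntidiagonal,
      (if Even p.2 then (p.1 : ℤ) else 0) - ∑ p ∈ n.divisorsAntidiagonal,
      (if Even p.1 then (p.1 : ℤ) else 0) + ∑ p ∈ n.divisorsAntidiagonal,
      (if Even p.2 then if Even p.1 then (p.1 : ℤ) else 0 else 0) := by
    rw [paperB, ← sigmaInt, sigmaInt_eq]
    simp only [← Finset.sum_sub_distrib, ← Finset.sum_add_distrib]
    split_ifs with hn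
    · refine Finset.sum_congr rfl fun p hp => ?_
      rw [← (Nat.mem_divisorsAntidiagonal.1 hp).1, Nat.odd_mul] at hn
      simp [Nat.not_even_iff_odd.2 hn.1, Nat.not_even_iff_odd.2 hn.2]
    · refine (Finset.sum_eq_zero fun p hp => ?_).symm
      rw [← (Nat.mem_divisorsAntidiagonal.1 hp).1, Nat.odd_mul, not_and_or, Nat.not_odd_iff_even,
        Nat.not_odd_iff_even] at hn
      by_cases h1 : Even p.1 <;> by_cases h2 : Even p.2 <;> simp_all
  rw [this, sum_even_snd_fst, sum_even_fst_fst, sum_even_even_fst]; ring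

/-- The series `∑ c n * exp (-π n t)`. -/
def expSum (c : ℕ → ℤ) (t : ℝ) : ℝ := ∑' n : ℕ, (c n : ℝ) * rexp (-π * n * t)

lemma summable_expSum {c : ℕ → ℤ} {k : ℕ} (hc : ∀ n, |c n| ≤ (n : ℤ) ^ k) {t : ℝ} (ht : 0 < t) :
    Summable fun n : ℕ => (c n : ℝ) * rexp (-π * n * t) := by
  refine (Real.summable_pow_mul_exp_neg_nat_mul k (mul_pos pi_pos ht)).of_norm_bounded fun n => ?_
  rw [norm_mul, Real.norm_eq_abs, Real.norm_eq_abs, Real.abs_exp,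
    show -π * n * t = -(π * t) * n by ring]
  gcongr
  exact_mod_cast hc n

lemma sigmaInt_nonneg (n : ℕ) : 0 ≤ sigmaInt n := Int.natCast_nonneg _

lemma sigmaInt_le (n : ℕ) : sigmaInt n ≤ (n : ℤ) ^ 2 := by
  rw [sigmaInt]
  exact_mod_cast ArithmeticFunction.sigma_le_pow_succ 1 n

lemma abs_sigmaInt_le (n : ℕ) : |sigmaInt n| ≤ (n : ℤ) ^ 2 := by
  rw [abs_of_nonneg (sigmaInt_nonneg n)]; exact sigmaInt_le n

lemma abs_altSigma_le_sigmaInt (n : ℕ) : |altSigma n| ≤ sigmaInt n := by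
  rw [altSigma, sigmaInt_eq]
  refine (Finset.abs_sum_le_sum_abs _ _).trans (Finset.sum_le_sum fun p _ => ?_)
  simp [abs_mul]

lemma abs_altSigma_le (n : ℕ) : |altSigma n| ≤ (n : ℤ) ^ 2 :=
  (abs_altSigma_le_sigmaInt n).trans (sigmaInt_le n)

lemma abs_mul_altSigma_le (n : ℕ) : |n * altSigma n| ≤ (n : ℤ) ^ 3 := by
  rw [abs_mul, pow_succ', Nat.abs_cast]
  gcongr
  exact abs_altSigma_le n

lemma paperA_nonneg (n : ℕ) : 0 ≤ paperA n := by
  rw [paperA]; positivity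

lemma abs_paperA_le (n : ℕ) : |paperA n| ≤ (n : ℤ) ^ 2 := by
  refine le_trans ?_ (sigmaInt_le n)
  rw [abs_of_nonneg (paperA_nonneg n), paperA_eq_oddCofactorSum, oddCofactorSum, sigmaInt_eq]
  refine Finset.sum_le_sum fun p _ => ?_
  split_ifs <;> simp

lemma paperB_nonneg (n : ℕ) : 0 ≤ paperB n := by
  rw [paperB]; positivity

lemma abs_paperB_le (n : ℕ) : |paperB n| ≤ (n : ℤ) ^ 2 := by
  refine le_trans ?_ (sigmaInt_le n)
  rw [abs_of_nonneg (paperB_nonneg n), paperB]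
  split_ifs
  · exact le_rfl
  · exact sigmaInt_nonneg n

lemma abs_dilate_le {c : ℕ → ℤ} {k : ℕ} (hc : ∀ n, |c n| ≤ (n : ℤ) ^ k) (n : ℕ) :
    |dilate c n| ≤ (n : ℤ) ^ k := by
  rw [dilate]
  split_ifs
  · refine (hc _).trans ?_
    gcongr
    exact Nat.div_le_self n 2
  · rw [abs_zero]; positivity

lemma expSum_dilate (c : ℕ → ℤ) (t : ℝ) : expSum (dilate c) t = expSum c (2 * t) := by
  have hinj : Function.Injective fun n : ℕ => 2 * n := fun a b h => by simpa using h
  rw [expSum, ← hinj.tsum_eq]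
  · refine tsum_congr fun n => ?_
    rw [dilate, if_pos (even_two_mul n), Nat.mul_div_cancel_left n two_pos]
    push_cast
    ring_nf
  · intro n hn
    by_contra h
    refine hn ?_
    have : ¬ Even n := fun he => h ⟨n / 2, Nat.two_mul_div_two_of_even he⟩
    simp [dilate, this]

lemma expSum_altSigma {t : ℝ} (ht : 0 < t) : expSum altSigma t =
    expSum sigmaInt t - 6 * expSum sigmaInt (2 * t) + 8 * expSum sigmaInt (4 * t) := by
  have h0 := summable_expSum abs_sigmaInt_le ht
  have h1 := summable_expSum (abs_dilate_le abs_sigmaInt_le) ht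
  have h2 := summable_expSum (abs_dilate_le (abs_dilate_le abs_sigmaInt_le)) ht
  rw [show 4 * t = 2 * (2 * t) by ring, ← expSum_dilate, ← expSum_dilate, ← expSum_dilate]
  simp only [expSum]
  rw [← tsum_mul_left, ← tsum_mul_left, ← h0.tsum_sub (h1.mul_left 6),
    ← (h0.sub (h1.mul_left 6)).tsum_add (h2.mul_left 8)]
  refine tsum_congr fun n => ?_
  rw [altSigma_eq]; push_cast; ring

lemma expSum_paperB {t : ℝ} (ht : 0 < t) : expSum paperB t =
    expSum sigmaInt t - 3 * expSum sigmaInt (2 * t) + 2 * expSum sigmaInt (4 * t) := by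
  have h0 := summable_expSum abs_sigmaInt_le ht
  have h1 := summable_expSum (abs_dilate_le abs_sigmaInt_le) ht
  have h2 := summable_expSum (abs_dilate_le (abs_dilate_le abs_sigmaInt_le)) ht
  rw [show 4 * t = 2 * (2 * t) by ring, ← expSum_dilate, ← expSum_dilate, ← expSum_dilate]
  simp only [expSum]
  rw [← tsum_mul_left, ← tsum_mul_left, ← h0.tsum_sub (h1.mul_left 3),
    ← (h0.sub (h1.mul_left 3)).tsum_add (h2.mul_left 2)]
  refine tsum_congr fun n => ?_
  rw [paperB_eq]; push_cast; ring

lemma G2_I_mul {y : ℝ} (hy : 0 < y) (z : UpperHalfPlane) (hz : (z : ℂ) = I * y) :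
    EisensteinSeries.G2 z = (π : ℂ) ^ 2 / 3 * (1 - 24 * expSum sigmaInt (2 * y)) := by
  have key : ∑' n : ℕ+, (ArithmeticFunction.sigma 1 n : ℂ) *
      cexp (2 * π * I * z) ^ (n : ℕ) = (expSum sigmaInt (2 * y) : ℝ) := by
    rw [tsum_pnat_eq_tsum_succ
      (f := fun n : ℕ => (ArithmeticFunction.sigma 1 n : ℂ) * cexp (2 * π * I * z) ^ n), expSum,
      (summable_expSum abs_sigmaInt_le (by positivity)).tsum_eq_zero_add]
    push_cast
    simp only [sigmaInt, ArithmeticFunction.map_zero]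
    simp only [Nat.cast_zero, Int.cast_zero, zero_mul, zero_add]
    refine tsum_congr fun n => ?_
    rw [← Complex.exp_nat_mul, hz]
    push_cast
    congr 2
    linear_combination (2 * π * y * (n + 1 : ℂ)) * I_mul_I
  rw [EisensteinSeries.G2_eq_tsum_cexp, riemannZeta_two, key]
  ring

lemma expSum_sigmaInt_two_div {y : ℝ} (hy : 0 < y) :
    1 - 24 * expSum sigmaInt (2 / y) =
      -y ^ 2 * (1 - 24 * expSum sigmaInt (2 * y)) + 6 * y / π := by
  let z : UpperHalfPlane := ⟨I * y, by simpa using hy⟩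
  have hz : (z : ℂ) = I * y := rfl
  have hS : ((ModularGroup.S • z : UpperHalfPlane) : ℂ) = I * (y⁻¹ : ℝ) := by
    rw [UpperHalfPlane.modular_S_smul]
    simp [hz, mul_comm]
  have h := EisensteinSeries.G2_S_transform z
  rw [G2_I_mul hy z hz, G2_I_mul (inv_pos.2 hy) _ hS, hz] at h
  have hy' : (y : ℂ) ≠ 0 := by exact_mod_cast hy.ne'
  have hpi : (π : ℂ) ≠ 0 := by exact_mod_cast pi_ne_zero
  rw [← div_eq_mul_inv] at h
  apply_fun ((↑) : ℝ → ℂ) using ofReal_injective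
  push_cast
  field_simp at h ⊢
  simp only [I_sq] at h
  generalize (expSum sigmaInt (2 / y) : ℂ) = u at *
  generalize (expSum sigmaInt (2 * y) : ℂ) = v at *
  linear_combination -h

lemma expSum_paperB_inv {t : ℝ} (ht : 0 < t) :
    expSum paperB t⁻¹ = t ^ 2 / 16 * (1 - 8 * expSum altSigma t) := by
  have h1 := expSum_sigmaInt_two_div (mul_pos two_pos ht)
  have h2 := expSum_sigmaInt_two_div ht
  have h3 := expSum_sigmaInt_two_div (half_pos ht)
  rw [show 2 / (2 * t) = t⁻¹ by field_simp, show 2 * (2 * t) = 4 * t by ring] at h1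
  rw [show 2 / t = 2 * t⁻¹ by field_simp] at h2
  rw [show 2 / (t / 2) = 4 * t⁻¹ by field_simp; norm_num, show 2 * (t / 2) = t by ring] at h3
  rw [expSum_altSigma ht, expSum_paperB (inv_pos.2 ht)]
  linear_combination -h1 / 24 + 3 / 24 * h2 - 2 / 24 * h3

lemma expSum_paperA_mul_expSum_altSigma {t : ℝ} (ht : 0 < t) :
    expSum paperA t * (1 - 8 * expSum altSigma t) = expSum (fun n => n * altSigma n) t := by
  have hA := summable_expSum abs_paperA_le ht
  have hH := summable_expSum abs_altSigma_le ht
  have hJ : Summable fun n : ℕ => (((n * altSigma n : ℤ)) : ℝ) * rexp (-π * n * t) :=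
    summable_expSum abs_mul_altSigma_le ht
  have hc : expSum paperA t * expSum altSigma t = ∑' n : ℕ, 8⁻¹ *
      (((paperA n : ℤ) : ℝ) * rexp (-π * n * t) - ((n * altSigma n : ℤ) : ℝ) * rexp (-π * n * t)) := by
    rw [expSum, expSum, tsum_mul_tsum_eq_tsum_sum_antidiagonal_of_summable_norm hA.norm hH.norm]
    refine tsum_congr fun n => ?_
    have h := eight_mul_sum_antidiagonal n
    simp only [← paperA_eq_oddCofactorSum] at h
    have h' : (∑ p ∈ Finset.HasAntidiagonal.antidiagonal n, (paperA p.1 * altSigma p.2 : ℝ)) =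
        8⁻¹ * (paperA n - n * altSigma n) := by
      rw [eq_inv_mul_iff_mul_eq₀ (by norm_num)]
      exact_mod_cast h
    push_cast
    rw [← sub_mul, ← mul_assoc, ← h', Finset.sum_mul]
    refine Finset.sum_congr rfl fun p hp => ?_
    rw [← Finset.HasAntidiagonal.mem_antidiagonal.1 hp, mul_mul_mul_comm, ← Real.exp_add]
    push_cast
    ring_nf
  rw [tsum_mul_left, hA.tsum_sub hJ] at hc
  simp only [expSum] at hc ⊢
  linear_combination -8 * hc

lemma expSum_paperA_mul_expSum_paperB_inv {t : ℝ} (ht : 0 < t) :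
    expSum paperA t * expSum paperB t⁻¹ = t ^ 2 / 16 * expSum (fun n => n * altSigma n) t := by
  rw [expSum_paperB_inv ht, ← expSum_paperA_mul_expSum_altSigma ht]
  ring

lemma LSeriesHasSum_neg_one_pow {w : ℂ} (hw : 1 < w.re) :
    LSeriesHasSum (fun n => (-1) ^ n) w ((2 ^ (1 - w) - 1) * riemannZeta w) := by
  have hinj : Function.Injective fun n : ℕ => 2 * n := fun a b h => by simpa using h
  have heven : LSeriesHasSum (fun n => if Even n then 1 else 0) w (2 ^ (-w) * riemannZeta w) := by
    rw [LSeriesHasSum, ← hinj.hasSum_iff]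
    · convert! (LSeriesHasSum_one hw).mul_left ((2 : ℂ) ^ (-w)) using 2 with n
      rcases eq_or_ne n 0 with rfl | hn
      · simp
      · rw [Function.comp_apply, LSeries.term_of_ne_zero (by omega), LSeries.term_of_ne_zero hn,
          if_pos (even_two_mul n), Nat.cast_mul, natCast_mul_natCast_cpow, cpow_neg]
        simp [mul_comm]
    · intro n hn
      have : ¬ Even n := fun he => hn ⟨n / 2, Nat.two_mul_div_two_of_even he⟩
      simp [LSeries.term_def, this]
  convert! (heven.smul 2).sub (LSeriesHasSum_one hw) using 1
  · ext n
    rcases Nat.even_or_odd n with h | h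
    · simp [h, h.neg_one_pow]; norm_num
    · simp [Nat.not_even_iff_odd.2 h, h.neg_one_pow]
  · rw [sub_eq_add_neg 1 w, cpow_add _ _ two_ne_zero, cpow_one]
    ring

lemma LSeriesHasSum_altSigma {s : ℂ} (hs : 1 < s.re) :
    LSeriesHasSum (fun n => (altSigma n : ℂ)) (s + 1)
      (((2 ^ (1 - s) - 1) * riemannZeta s) * ((2 ^ (-s) - 1) * riemannZeta (s + 1))) := by
  have h1 : LSeriesHasSum (fun n => (-1) ^ n * (n : ℂ)) (s + 1)
      ((2 ^ (1 - s) - 1) * riemannZeta s) := by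
    have h := LSeriesHasSum_neg_one_pow hs
    rw [LSeriesHasSum] at h ⊢
    convert! h using 1
    ext n
    rcases eq_or_ne n 0 with rfl | hn
    · simp
    · have : (n : ℂ) ≠ 0 := by exact_mod_cast hn
      rw [LSeries.term_of_ne_zero hn, LSeries.term_of_ne_zero hn, cpow_add _ _ this, cpow_one,
        mul_div_mul_right _ _ this]
  have h2 := LSeriesHasSum_neg_one_pow (w := s + 1) (by simp; linarith)
  rw [show 1 - (s + 1) = -s by ring] at h2
  convert! h1.convolution h2 using 1
  rw [LSeries.convolution_def]
  ext n
  rw [altSigma]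
  push_cast
  refine Finset.sum_congr rfl fun p _ => ?_
  ring

lemma norm_div_rpow_eq_norm_term (s : ℂ) (n : ℕ) :
    ‖((n * altSigma n : ℤ) : ℂ)‖ / (n : ℝ) ^ (s + 2).re =
      ‖LSeries.term (fun n => (altSigma n : ℂ)) (s + 1) n‖ := by
  rcases eq_or_ne n 0 with rfl | hn
  · simp
  have hn' : (n : ℝ) ≠ 0 := by exact_mod_cast hn
  rw [LSeries.norm_term_eq, if_neg hn, show (s + 2).re = (s + 1).re + 1 by simp; ring,
    Real.rpow_add_one hn']
  push_cast
  rw [norm_mul, Complex.norm_natCast, mul_comm, mul_div_mul_right _ _ hn']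

lemma mellin_expSum {s : ℂ} (hs : 1 < s.re) :
    mellin (fun t => (expSum (fun n => n * altSigma n) t : ℂ)) (s + 2) =
      π ^ (-(s + 2)) * Complex.Gamma (s + 2) *
        (((2 ^ (1 - s) - 1) * riemannZeta s) * ((2 ^ (-s) - 1) * riemannZeta (s + 1))) := by
  have h := hasSum_mellin_pi_mul (a := fun n : ℕ => ((n * altSigma n : ℤ) : ℂ))
    (q := fun n : ℕ => (n : ℝ)) (s := s + 2)
    (F := fun t => (expSum (fun n => n * altSigma n) t : ℂ)) (fun n => ?_) ?_ ?_ ?_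
  · refine h.unique ?_
    convert! (LSeriesHasSum_altSigma hs).mul_left (π ^ (-(s + 2)) * Complex.Gamma (s + 2)) using 2
      with n
    rcases eq_or_ne n 0 with rfl | hn
    · simp
    have hn' : (n : ℂ) ≠ 0 := by exact_mod_cast hn
    rw [LSeries.term_of_ne_zero hn, show s + 2 = s + 1 + 1 by ring, ofReal_natCast,
      cpow_add (s + 1) 1 hn', cpow_one]
    push_cast
    field_simp
  · rcases Nat.eq_zero_or_pos n with rfl | hn
    · simp
    · right; exact_mod_cast hn
  · simp; linarith
  · intro t ht
    have : Summable fun n : ℕ => ((n * altSigma n : ℤ) : ℝ) * rexp (-π * n * t) :=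
      summable_expSum (k := 3) abs_mul_altSigma_le ht
    convert! (hasSum_ofReal.2 this.hasSum) using 2 with n
    push_cast; rfl
  · simp_rw [norm_div_rpow_eq_norm_term]
    exact (LSeriesHasSum_altSigma hs).summable.norm

lemma summable_integral_norm_of_hasSum {α ι κ E : Type*} [MeasurableSpace α] {μ : Measure α}
    [NormedAddCommGroup E] [Countable ι] [Countable κ] {F : ι → α → E} {G : κ → α → ℝ} {T : α → ℝ}
    (hF : ∀ i, Integrable (F i) μ) (hG : ∀ k, Integrable (G k) μ)
    (hG_sum : Summable fun k => ∫ x, ‖G k x‖ ∂μ)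
    (hFT : ∀ᵐ x ∂μ, HasSum (fun i => ‖F i x‖) (T x)) (hGT : ∀ᵐ x ∂μ, HasSum (fun k => G k x) (T x)) :
    Summable fun i => ∫ x, ‖F i x‖ ∂μ := by
  have key : ∑' i, ENNReal.ofReal (∫ x, ‖F i x‖ ∂μ) ≤ ∑' k, ENNReal.ofReal (∫ x, ‖G k x‖ ∂μ) := by
    simp_rw [ofReal_integral_norm_eq_lintegral_enorm (hF _),
      ofReal_integral_norm_eq_lintegral_enorm (hG _)]
    rw [← lintegral_tsum fun i => (hF i).1.enorm, ← lintegral_tsum fun k => (hG k).1.enorm]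
    refine lintegral_mono_ae ?_
    filter_upwards [hFT, hGT] with x h1 h2
    simp_rw [← ofReal_norm]
    rw [← ENNReal.ofReal_tsum_of_nonneg (fun i => norm_nonneg _) h1.summable,
      ← ENNReal.ofReal_tsum_of_nonneg (fun i => norm_nonneg _) h2.summable.norm, h1.tsum_eq,
      ← h2.tsum_eq]
    exact ENNReal.ofReal_le_ofReal (h2.summable.tsum_le_tsum (fun k => le_norm_self _)
      h2.summable.norm)
  rw [← ENNReal.ofReal_tsum_of_nonneg (fun k => integral_nonneg fun x => norm_nonneg _) hG_sum] at key
  have hne := (key.trans_lt ENNReal.ofReal_lt_top).ne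
  have := ENNReal.summable_toReal hne
  simpa only [ENNReal.toReal_ofReal (integral_nonneg fun x => norm_nonneg _)] using this

/-- The term `t ^ (s - 1) * a(m) e^{-π m t} * b(n) e^{-π n / t}`. -/
def kernelTerm (s : ℂ) (p : ℕ × ℕ) (t : ℝ) : ℂ :=
  (t : ℂ) ^ (s - 1) * ((paperA p.1 * rexp (-π * p.1 * t) * (paperB p.2 * rexp (-π * p.2 * t⁻¹)) : ℝ) : ℂ)

lemma integrableOn_rpow_mul_exp {r b : ℝ} (hr : -1 < r) (hb : 0 < b) :
    IntegrableOn (fun t : ℝ => t ^ r * rexp (-b * t)) (Set.Ioi 0) := by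
  simpa using integrableOn_rpow_mul_exp_neg_mul_rpow hr one_pos hb

lemma paperA_zero : paperA 0 = 0 := by simp [paperA]

lemma paperB_zero : paperB 0 = 0 := by simp [paperB]

lemma norm_kernelTerm (s : ℂ) (p : ℕ × ℕ) {t : ℝ} (ht : 0 < t) :
    ‖kernelTerm s p t‖ =
      t ^ (s.re - 1) * (paperA p.1 * rexp (-π * p.1 * t) * (paperB p.2 * rexp (-π * p.2 * t⁻¹))) := by
  have hA : (0 : ℝ) ≤ paperA p.1 := by exact_mod_cast paperA_nonneg _
  have hB : (0 : ℝ) ≤ paperB p.2 := by exact_mod_cast paperB_nonneg _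
  rw [kernelTerm, norm_mul, norm_cpow_eq_rpow_re_of_pos ht, Complex.norm_real, Real.norm_of_nonneg]
  · simp
  · positivity

lemma integrableOn_kernelTerm {s : ℂ} (hs : 0 < s.re) (p : ℕ × ℕ) :
    IntegrableOn (kernelTerm s p) (Set.Ioi 0) := by
  obtain ⟨m, n⟩ := p
  rcases Nat.eq_zero_or_pos m with rfl | hm
  · have : kernelTerm s (0, n) = 0 := by ext; simp [kernelTerm, paperA_zero]
    rw [this]
    exact integrableOn_zero
  have hm' : (0 : ℝ) < m := by exact_mod_cast hm
  have hb := (integrableOn_rpow_mul_exp (r := s.re - 1) (by linarith)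
    (mul_pos pi_pos hm')).const_mul (paperA m * paperB n : ℝ)
  refine hb.mono' ?_ ?_
  · refine ContinuousOn.aestronglyMeasurable (fun t ht => ?_) measurableSet_Ioi
    have h0 : t ≠ 0 := (Set.mem_Ioi.1 ht).ne'
    refine ContinuousAt.continuousWithinAt ?_
    unfold kernelTerm
    refine ContinuousAt.mul ?_ ?_
    · exact continuousAt_ofReal_cpow_const _ _ (Or.inr h0)
    · refine continuous_ofReal.continuousAt.comp ?_
      have := continuousAt_inv₀ h0
      fun_prop
  · refine (ae_restrict_iff' measurableSet_Ioi).2 (Filter.Eventually.of_forall fun t ht => ?_)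
    have ht : 0 < t := ht
    have hA : (0 : ℝ) ≤ paperA m := by exact_mod_cast paperA_nonneg _
    have hB : (0 : ℝ) ≤ paperB n := by exact_mod_cast paperB_nonneg _
    have h1 : rexp (-π * n * t⁻¹) ≤ 1 := by
      rw [Real.exp_le_one_iff, neg_mul, neg_mul, neg_nonpos]
      positivity
    rw [norm_kernelTerm s _ ht]
    calc t ^ (s.re - 1) * (paperA m * rexp (-π * m * t) * (paperB n * rexp (-π * n * t⁻¹)))
        ≤ t ^ (s.re - 1) * (paperA m * rexp (-π * m * t) * (paperB n * 1)) := by gcongr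
      _ = _ := by rw [neg_mul]; ring

lemma hasSum_paperA_mul_paperB {t : ℝ} (ht : 0 < t) :
    HasSum (fun p : ℕ × ℕ =>
      paperA p.1 * rexp (-π * p.1 * t) * (paperB p.2 * rexp (-π * p.2 * t⁻¹)))
      (t ^ 2 / 16 * expSum (fun n => n * altSigma n) t) := by
  have hA := summable_expSum abs_paperA_le ht
  have hB := summable_expSum abs_paperB_le (inv_pos.2 ht)
  rw [← expSum_paperA_mul_expSum_paperB_inv ht]
  exact hA.hasSum.mul hB.hasSum (summable_mul_of_summable_norm hA.norm hB.norm)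

lemma hasSum_kernelTerm (s : ℂ) {t : ℝ} (ht : 0 < t) :
    HasSum (fun p => kernelTerm s p t)
      ((t : ℂ) ^ (s - 1) * (t ^ 2 / 16 * expSum (fun n => n * altSigma n) t : ℝ)) :=
  (hasSum_ofReal.2 (hasSum_paperA_mul_paperB ht)).mul_left _

lemma summable_integral_norm_kernelTerm {s : ℂ} (hs : 1 < s.re) :
    Summable fun p => ∫ t in Set.Ioi 0, ‖kernelTerm s p t‖ := by
  have hpos : 0 < s.re + 2 := by linarith
  have hint : ∀ n : ℕ, n ≠ 0 →
      IntegrableOn (fun t : ℝ => t ^ (s.re + 1) * rexp (-(π * n) * t)) (Set.Ioi 0) := fun n hn => by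
    have : (0 : ℝ) < n := by positivity
    exact integrableOn_rpow_mul_exp (by linarith) (by positivity)
  refine summable_integral_norm_of_hasSum (integrableOn_kernelTerm (by linarith))
    (G := fun n : ℕ => fun t : ℝ => (16⁻¹ * (n * altSigma n) : ℝ) *
      (t ^ (s.re + 1) * rexp (-(π * n) * t)))
    (T := fun t => t ^ (s.re - 1) * (t ^ 2 / 16 * expSum (fun n => n * altSigma n) t)) ?_ ?_ ?_ ?_
  · intro n
    rcases eq_or_ne n 0 with rfl | hn
    · simp
    · exact (hint n hn).const_mul _
  · have h := ((LSeriesHasSum_altSigma hs).summable.norm).mul_left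
      (16⁻¹ * π⁻¹ ^ (s.re + 2) * Real.Gamma (s.re + 2))
    refine h.congr fun n => ?_
    rw [← norm_div_rpow_eq_norm_term]
    simp_rw [norm_mul]
    rw [integral_const_mul]
    rcases eq_or_ne n 0 with rfl | hn
    · simp
    have hn' : (0 : ℝ) < n := by positivity
    have e : ∫ t in Set.Ioi (0 : ℝ), ‖t ^ (s.re + 1)‖ * ‖rexp (-(π * n) * t)‖ =
        (1 / (π * n)) ^ (s.re + 2) * Real.Gamma (s.re + 2) := by
      rw [← Real.integral_rpow_mul_exp_neg_mul_Ioi hpos (by positivity : 0 < π * n)]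
      refine setIntegral_congr_fun measurableSet_Ioi fun t ht => ?_
      have ht : 0 < t := ht
      rw [Real.norm_of_nonneg (by positivity), Real.norm_of_nonneg (by positivity), neg_mul,
        show s.re + 2 - 1 = s.re + 1 by ring]
    rw [e, one_div, mul_inv, Real.mul_rpow (by positivity) (by positivity), Real.inv_rpow hn'.le]
    simp only [Int.cast_mul, Int.cast_natCast, norm_mul, Complex.norm_natCast, add_re,
      Complex.norm_intCast, re_ofNat, Real.norm_eq_abs]
    rw [abs_of_pos (by norm_num : (0 : ℝ) < 16⁻¹)]
    rw [Nat.abs_cast]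
    field_simp
  · refine (ae_restrict_iff' measurableSet_Ioi).2 (Filter.Eventually.of_forall fun t ht => ?_)
    have ht : 0 < t := ht
    simp_rw [norm_kernelTerm s _ ht]
    exact (hasSum_paperA_mul_paperB ht).mul_left _
  · refine (ae_restrict_iff' measurableSet_Ioi).2 (Filter.Eventually.of_forall fun t ht => ?_)
    have ht : 0 < t := ht
    have h := (summable_expSum abs_mul_altSigma_le ht).hasSum.mul_left (t ^ (s.re - 1) * (t ^ 2 / 16))
    rw [← mul_assoc]
    convert! h using 2 with n
    rw [show s.re + 1 = s.re - 1 + 2 by ring, Real.rpow_add ht, Real.rpow_two]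
    push_cast
    ring_nf

lemma hasSum_integral_kernelTerm {s : ℂ} (hs : 1 < s.re) :
    HasSum (fun p => ∫ t in Set.Ioi 0, kernelTerm s p t)
      (16⁻¹ * mellin (fun t => (expSum (fun n => n * altSigma n) t : ℂ)) (s + 2)) := by
  have h := hasSum_integral_of_summable_integral_norm (integrableOn_kernelTerm (s := s) (by linarith))
    (summable_integral_norm_kernelTerm hs)
  convert! h using 1
  rw [mellin, ← integral_const_mul]
  refine setIntegral_congr_fun measurableSet_Ioi fun t ht => ?_
  have ht : 0 < t := ht
  have ht' : (t : ℂ) ≠ 0 := by exact_mod_cast ht.ne'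
  rw [(hasSum_kernelTerm s ht).tsum_eq, show s + 2 - 1 = s - 1 + 2 by ring, cpow_add _ _ ht',
    cpow_ofNat, smul_eq_mul]
  push_cast
  ring

lemma integral_kernelTerm (s : ℂ) {m n : ℕ} (hm : 0 < m) (hn : 0 < n) :
    ∫ t in Set.Ioi 0, kernelTerm s (m, n) t = 2 * lemma1Term s (m * n) m := by
  obtain ⟨p, hp, hpm⟩ : ∃ p : ℝ, 0 < p ∧ p * p = m :=
    ⟨√m, Real.sqrt_pos.2 (by exact_mod_cast hm), Real.mul_self_sqrt (by positivity)⟩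
  obtain ⟨q, hq, hqn⟩ : ∃ q : ℝ, 0 < q ∧ q * q = n :=
    ⟨√n, Real.sqrt_pos.2 (by exact_mod_cast hn), Real.mul_self_sqrt (by positivity)⟩
  set c : ℝ := p / q with hc
  have hc0 : 0 < c := by positivity
  have hp' : (p : ℂ) ≠ 0 := by exact_mod_cast hp.ne'
  have hq' : (q : ℂ) ≠ 0 := by exact_mod_cast hq.ne'
  have hc' : (c : ℂ) ≠ 0 := by exact_mod_cast hc0.ne'
  have hpm' : (m : ℂ) = p * p := by exact_mod_cast hpm.symm
  have hqn' : (n : ℂ) = q * q := by exact_mod_cast hqn.symm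
  have hsqrt : √((m * n : ℕ) : ℝ) = p * q := by
    rw [Nat.cast_mul, ← hpm, ← hqn, show p * p * (q * q) = (p * q) * (p * q) by ring,
      Real.sqrt_mul_self (by positivity)]
  have hpow : (((m * n : ℕ) : ℂ) / (m : ℂ) ^ 2) ^ (s / 2) = ((c⁻¹ : ℝ) : ℂ) ^ s := by
    have e : ((m * n : ℕ) : ℂ) / (m : ℂ) ^ 2 = ((c⁻¹ : ℝ) : ℂ) * ((c⁻¹ : ℝ) : ℂ) := by
      rw [hc]; push_cast; rw [hpm', hqn']; field_simp
    have hci : ((c⁻¹ : ℝ) : ℂ) ≠ 0 := by exact_mod_cast (inv_pos.2 hc0).ne'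
    rw [e, mul_cpow_ofReal_nonneg (by positivity) (by positivity), ← cpow_add _ _ hci, add_halves]
  have hcs : ((c⁻¹ : ℝ) : ℂ) ^ s * ((c : ℂ) * (c : ℂ) ^ (s - 1)) = 1 := by
    rw [cpow_sub _ _ hc', cpow_one, mul_div_cancel₀ _ hc',
      ← mul_cpow_ofReal_nonneg (by positivity) hc0.le, ← ofReal_mul, inv_mul_cancel₀ hc0.ne', ofReal_one, one_cpow]
  have hint := integral_comp_mul_left_Ioi (fun u : ℝ => (u : ℂ) ^ (s - 1) *
    cexp (-(((2 * π * √((m * n : ℕ) : ℝ) : ℝ) : ℂ) / 2) * (u + 1 / u))) 0 hc0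
  rw [mul_zero, eq_inv_smul_iff₀ hc0.ne'] at hint
  rw [lemma1Term, besselK, Nat.mul_div_cancel_left n hm, hpow, ← hint]
  have hk : ∀ t ∈ Set.Ioi (0 : ℝ), kernelTerm s (m, n) t = (paperA m * paperB n : ℂ) *
      (((c⁻¹ : ℝ) : ℂ) ^ s * c) * (((c * t : ℝ) : ℂ) ^ (s - 1) *
        cexp (-(((2 * π * √((m * n : ℕ) : ℝ) : ℝ) : ℂ) / 2) * ((c * t : ℝ) + 1 / (c * t : ℝ)))) := by
    intro t ht
    have ht : 0 < t := ht
    have ht' : (t : ℂ) ≠ 0 := by exact_mod_cast ht.ne'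
    have he : -(((2 * π * √((m * n : ℕ) : ℝ) : ℝ) : ℂ) / 2) * ((c * t : ℝ) + 1 / (c * t : ℝ)) =
        -π * m * t + -π * n * (t : ℂ)⁻¹ := by
      rw [hsqrt, hpm', hqn', hc]
      push_cast
      field_simp
      ring
    rw [he, Complex.exp_add, ofReal_mul, mul_cpow_ofReal_nonneg hc0.le ht.le, kernelTerm]
    push_cast at hcs ⊢
    linear_combination -((paperA m : ℂ) * paperB n * t ^ (s - 1) * cexp (-π * m * t) *
      cexp (-π * n * (t : ℂ)⁻¹)) * hcs
  rw [setIntegral_congr_fun measurableSet_Ioi hk, integral_const_mul, real_smul]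
  ring

/-- The pair of complementary divisors attached to a divisor `d` of `j`. -/
def divisorPair (p : (j : ℕ) × {d : ℕ // d ∈ j.divisors}) : ℕ × ℕ := (p.2.1, p.1 / p.2.1)

lemma divisorPair_injective : Function.Injective divisorPair := by
  rintro ⟨j, d, hd⟩ ⟨j', d', hd'⟩ h
  obtain ⟨k, rfl⟩ := Nat.dvd_of_mem_divisors hd
  obtain ⟨k', rfl⟩ := Nat.dvd_of_mem_divisors hd'
  have hd0 := Nat.pos_of_mem_divisors hd
  have hd0' := Nat.pos_of_mem_divisors hd'
  simp only [divisorPair, Nat.mul_div_cancel_left _ hd0, Nat.mul_div_cancel_left _ hd0',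
    Prod.mk.injEq] at h
  obtain ⟨rfl, rfl⟩ := h
  rfl

lemma integral_kernelTerm_divisorPair (s : ℂ) (p : (j : ℕ) × {d : ℕ // d ∈ j.divisors}) :
    ∫ t in Set.Ioi 0, kernelTerm s (divisorPair p) t = 2 * lemma1Term s p.1 p.2.1 := by
  obtain ⟨j, d, hd⟩ := p
  obtain ⟨⟨k, rfl⟩, h0⟩ := Nat.mem_divisors.1 hd
  have hd0 := Nat.pos_of_mem_divisors hd
  rw [divisorPair, Nat.mul_div_cancel_left k hd0,
    integral_kernelTerm s hd0 (Nat.pos_of_ne_zero (right_ne_zero_of_mul h0))]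

lemma kernelTerm_eq_zero_of_notMem_range (s : ℂ) {p : ℕ × ℕ} (hp : p ∉ Set.range divisorPair) :
    kernelTerm s p = 0 := by
  obtain ⟨m, n⟩ := p
  ext t
  rcases Nat.eq_zero_or_pos m with rfl | hm
  · simp [kernelTerm, paperA_zero]
  rcases Nat.eq_zero_or_pos n with rfl | hn
  · simp [kernelTerm, paperB_zero]
  refine absurd ⟨⟨m * n, m, Nat.mem_divisors.2 ⟨dvd_mul_right _ _, by positivity⟩⟩, ?_⟩ hp
  simp [divisorPair, Nat.mul_div_cancel_left n hm]

lemma summable_norm_lemma1Term {s : ℂ} (hs : 1 < s.re) :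
    Summable fun p : (j : ℕ) × {d : ℕ // d ∈ j.divisors} => ‖lemma1Term s p.1 p.2.1‖ := by
  refine ((summable_integral_norm_kernelTerm hs).comp_injective
    divisorPair_injective).of_nonneg_of_le (fun p => norm_nonneg _) fun p => ?_
  have h := norm_integral_le_integral_norm (μ := volume.restrict (Set.Ioi 0))
    (kernelTerm s (divisorPair p))
  rw [integral_kernelTerm_divisorPair, norm_mul, Complex.norm_ofNat] at h
  have := norm_nonneg (lemma1Term s p.1 p.2.1)
  simp only [Function.comp_apply]
  linarith

lemma hasSum_lemma1Term {s : ℂ} (hs : 1 < s.re) :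
    HasSum (fun p : (j : ℕ) × {d : ℕ // d ∈ j.divisors} => lemma1Term s p.1 p.2.1)
      (32⁻¹ * mellin (fun t => (expSum (fun n => n * altSigma n) t : ℂ)) (s + 2)) := by
  have h := hasSum_integral_kernelTerm hs
  rw [← divisorPair_injective.hasSum_iff fun p hp => by
    simp [kernelTerm_eq_zero_of_notMem_range s hp]] at h
  convert! h.mul_left 2⁻¹ using 1
  · ext p
    rw [Function.comp_apply, integral_kernelTerm_divisorPair, inv_mul_cancel_left₀ two_ne_zero]
  · ring

lemma zetaStar_mul_zetaStar_eq (s : ℂ) (hs : 0 < s.re) :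
    s * (s + 1) / (32 * (π : ℂ) ^ 2 * (Real.sqrt 2 : ℂ)) *
        ((2 : ℂ) ^ (s / 2) - 2 ^ (-s / 2)) *
        ((2 : ℂ) ^ ((s - 1) / 2) - 2 ^ (-(s - 1) / 2)) * zetaStar s * zetaStar (s + 1) =
      32⁻¹ * (π ^ (-(s + 2)) * Complex.Gamma (s + 2) *
        (((2 ^ (1 - s) - 1) * riemannZeta s) * ((2 ^ (-s) - 1) * riemannZeta (s + 1)))) := by
  have hpi : (π : ℂ) ≠ 0 := by exact_mod_cast pi_ne_zero
  have hs0 : s ≠ 0 := fun h => by simp [h] at hs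
  have hs1 : s + 1 ≠ 0 := fun h => by
    have := congrArg re h
    simp at this
    linarith
  have hG : Complex.Gamma (s + 2) = (s + 1) * (s * Complex.Gamma s) := by
    rw [← Complex.Gamma_add_one s hs0, ← Complex.Gamma_add_one _ hs1]
    ring_nf
  have hD := Complex.Gamma_mul_Gamma_add_half (s / 2)
  rw [show 2 * (s / 2) = s by ring, show s / 2 + 1 / 2 = (s + 1) / 2 by ring] at hD
  have hr : (Real.sqrt 2 : ℂ) * Real.sqrt 2 = 2 := by
    rw [← ofReal_mul, Real.mul_self_sqrt zero_le_two]; simp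
  have hr0 : (Real.sqrt 2 : ℂ) ≠ 0 := fun h => by simp [h] at hr
  have hrp : (2 : ℂ) ^ (1 / 2 : ℂ) = Real.sqrt 2 := by
    rw [Real.sqrt_eq_rpow, ofReal_cpow zero_le_two]; simp
  have hpip : (π : ℂ) ^ (1 / 2 : ℂ) = Real.sqrt π := by
    rw [Real.sqrt_eq_rpow, ofReal_cpow pi_pos.le]; simp
  have hx0 : (2 : ℂ) ^ (s / 2) ≠ 0 := by simp [cpow_eq_zero_iff]
  have e1 : (2 : ℂ) ^ (-s / 2) = ((2 : ℂ) ^ (s / 2))⁻¹ := by rw [neg_div, cpow_neg]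
  have e2 : (2 : ℂ) ^ ((s - 1) / 2) = (2 : ℂ) ^ (s / 2) / Real.sqrt 2 := by
    rw [← hrp, ← cpow_sub _ _ two_ne_zero]; ring_nf
  have e3 : (2 : ℂ) ^ (-(s - 1) / 2) = Real.sqrt 2 / (2 : ℂ) ^ (s / 2) := by
    rw [← hrp, ← cpow_sub _ _ two_ne_zero]; ring_nf
  have e4 : (2 : ℂ) ^ (-s) = ((2 : ℂ) ^ (s / 2) * 2 ^ (s / 2))⁻¹ := by
    rw [← cpow_add _ _ two_ne_zero, ← cpow_neg]; ring_nf
  have e5 : (2 : ℂ) ^ (1 - s) = 2 / ((2 : ℂ) ^ (s / 2) * 2 ^ (s / 2)) := by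
    rw [sub_eq_add_neg, cpow_add _ _ two_ne_zero, cpow_one, e4]; rfl
  have f1 : (π : ℂ) ^ (-(s + 2)) * π ^ 2 =
      π ^ (-s / 2) * π ^ (-(s + 1) / 2) * Real.sqrt π := by
    rw [← hpip, ← cpow_ofNat, ← cpow_add _ _ hpi, ← cpow_add _ _ hpi, ← cpow_add _ _ hpi]
    ring_nf
  rw [zetaStar, zetaStar, hG, e1, e2, e3, e4]
  rw [e5] at hD ⊢
  generalize (2 : ℂ) ^ (s / 2) = x at *
  generalize (Real.sqrt 2 : ℂ) = r at *
  have f2 : (π : ℂ) ^ (-(s + 2)) = π ^ (-s / 2) * π ^ (-(s + 1) / 2) * Real.sqrt π / π ^ 2 := by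
    rw [← f1]; field_simp
  rw [f2]
  have hprod : 1 / r * (x - x⁻¹) * (x / r - r / x) * (2 / (x * x)) =
      (2 / (x * x) - 1) * ((x * x)⁻¹ - 1) := by
    field_simp
    linear_combination (x ^ 2 - x ^ 4) * hr
  calc _ = s * (s + 1) / (32 * (π : ℂ) ^ 2) * (1 / r * (x - x⁻¹) * (x / r - r / x)) *
        (π ^ (-s / 2) * π ^ (-(s + 1) / 2)) *
        (Complex.Gamma (s / 2) * Complex.Gamma ((s + 1) / 2)) * riemannZeta s *
        riemannZeta (s + 1) := by field_simp
    _ = s * (s + 1) / (32 * (π : ℂ) ^ 2) *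
        (1 / r * (x - x⁻¹) * (x / r - r / x) * (2 / (x * x))) *
        (π ^ (-s / 2) * π ^ (-(s + 1) / 2) * Real.sqrt π) *
        Complex.Gamma s * riemannZeta s * riemannZeta (s + 1) := by rw [hD]; ring
    _ = _ := by rw [hprod]; ring

theorem lemma_one (s : ℂ) (hs : 1 < s.re) :
    Summable (fun p : (j : ℕ) × {d : ℕ // d ∈ j.divisors} => ‖lemma1Term s p.1 p.2.1‖) ∧
    s * (s + 1) / (32 * (π : ℂ) ^ 2 * (Real.sqrt 2 : ℂ)) *
        ((2 : ℂ) ^ (s / 2) - 2 ^ (-s / 2)) *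
        ((2 : ℂ) ^ ((s - 1) / 2) - 2 ^ (-(s - 1) / 2)) * zetaStar s * zetaStar (s + 1) =
      ∑' j : ℕ, ∑ d ∈ j.divisors, lemma1Term s j d := by
  refine ⟨summable_norm_lemma1Term hs, ?_⟩
  have h := hasSum_lemma1Term hs
  rw [zetaStar_mul_zetaStar_eq s (by linarith), ← mellin_expSum hs, ← h.tsum_eq,
    h.summable.tsum_sigma]
  exact tsum_congr fun j => Finset.tsum_subtype _ (lemma1Term s j)
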